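/- Let k be a field of characteristic p > 2 and a ∈ k. Let A_{a,2} denote k[T]/(T^{p²}) with the bialgebra structure in which Δ(T̄) = T̄⊗1 + 1⊗T̄ + a·T̄^{p}⊗T̄^{p} and the counit sends T̄ to 0, and let A_{0,2} denote k[T]/(T^{p²}) with the bialgebra structure in which T̄ is primitive (Δ(T̄) = T̄⊗1 + 1⊗T̄). Then the element T̄ − (a/2)·T̄^{2p} is primitive in A_{a,2}, and the k-algebra endomorphism of k[T]/(T^{p²}) determined by T̄ ↦ T̄ − (a/2)·T̄^{2p} is a bialgebra isomorphism from A_{0,2} to A_{a,2}. -/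

import Mathlib

open scoped TensorProduct

/-- `(Δ, ε)` is a bialgebra structure on the `k`-algebra `A`: the comultiplication `Δ` and
counit `ε` are `k`-algebra homomorphisms, `Δ` is coassociative and `ε` is a counit for `Δ`. -/
def IsBialgebraStructure (k A : Type*) [CommRing k] [CommRing A] [Algebra k A]
    (Δ : A →ₐ[k] A ⊗[k] A) (ε : A →ₐ[k] k) : Prop :=
  (∀ x : A, (TensorProduct.assoc k A A A)
      ((TensorProduct.map Δ.toLinearMap (LinearMap.id : A →ₗ[k] A)) (Δ x))
      = (TensorProduct.map (LinearMap.id : A →ₗ[k] A) Δ.toLinearMap) (Δ x)) ∧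
  (∀ x : A, (TensorProduct.lid k A)
      ((TensorProduct.map ε.toLinearMap (LinearMap.id : A →ₗ[k] A)) (Δ x)) = x) ∧
  (∀ x : A, (TensorProduct.rid k A)
      ((TensorProduct.map (LinearMap.id : A →ₗ[k] A) ε.toLinearMap) (Δ x)) = x)

/-- The truncated polynomial ring `k[T]/(T^N)`. -/
abbrev TruncPoly (k : Type*) [CommRing k] (N : ℕ) : Type _ :=
  Polynomial k ⧸ Ideal.span {(Polynomial.X : Polynomial k) ^ N}

/-- The class of `T` in `k[T]/(T^N)`. -/
noncomputable abbrev truncT (k : Type*) [CommRing k] (N : ℕ) : TruncPoly k N :=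
  Ideal.Quotient.mk _ Polynomial.X

theorem truncT_pow_self (k : Type*) [CommRing k] (N : ℕ) : truncT k N ^ N = 0 := by
  rw [← map_pow, Ideal.Quotient.eq_zero_iff_mem]
  exact Ideal.mem_span_singleton_self _

theorem TruncPoly.algHom_ext {k B : Type*} [CommRing k] [Semiring B] [Algebra k B] {N : ℕ}
    {f g : TruncPoly k N →ₐ[k] B} (h : f (truncT k N) = g (truncT k N)) : f = g :=
  Ideal.Quotient.algHom_ext _ (Polynomial.algHom_ext h)

/-- An endomorphism of `k[T]/(T^N)` whose image contains `T` is bijective. -/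
theorem TruncPoly.bijective_of_apply_eq {k : Type*} [Field k] {N : ℕ}
    (φ : TruncPoly k N →ₐ[k] TruncPoly k N) {y : TruncPoly k N} (hy : φ y = truncT k N) :
    Function.Bijective φ := by
  have hs : Function.Surjective φ := by
    intro x
    obtain ⟨f, rfl⟩ := Ideal.Quotient.mk_surjective x
    refine ⟨Polynomial.aeval y f, ?_⟩
    have h : (φ.comp (Polynomial.aeval y)) = Ideal.Quotient.mkₐ k _ :=
      Polynomial.algHom_ext (by simpa using hy)
    exact DFunLike.congr_fun h f
  have : Module.Finite k (TruncPoly k N) := (Polynomial.monic_X_pow N).finite_quotient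
  exact ⟨LinearMap.injective_iff_surjective (f := φ.toLinearMap).mpr hs, hs⟩

/-- In odd characteristic `p`, if `t ^ p ^ 2 = 0` and `Δ t = t ⊗ 1 + 1 ⊗ t + a • t ^ p ⊗ t ^ p`,
then `t - (a / 2) • t ^ (2 * p)` is primitive. -/
theorem comul_sub_half_smul_pow {k A : Type*} [Field k] [CommRing A] [Nontrivial A] [Algebra k A]
    (p : ℕ) [ExpChar k p] (h2 : (2 : k) ≠ 0) (a : k) (Δ : A →ₐ[k] A ⊗[k] A) (t : A)
    (ht : (t ^ p) ^ p = 0)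
    (hΔ : Δ t = t ⊗ₜ[k] (1 : A) + (1 : A) ⊗ₜ[k] t + a • ((t ^ p) ⊗ₜ[k] (t ^ p))) :
    Δ (t - (a / 2) • t ^ (2 * p)) =
      (t - (a / 2) • t ^ (2 * p)) ⊗ₜ[k] (1 : A) +
        (1 : A) ⊗ₜ[k] (t - (a / 2) • t ^ (2 * p)) := by
  have : ExpChar (A ⊗[k] A) p := expChar_of_injective_algebraMap
    (FaithfulSMul.algebraMap_injective k (A ⊗[k] A)) p
  have hp' : Δ t ^ p = (t ^ p) ⊗ₜ[k] (1 : A) + (1 : A) ⊗ₜ[k] (t ^ p) := by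
    rw [hΔ, add_pow_expChar, add_pow_expChar, smul_pow]
    simp only [Algebra.TensorProduct.tmul_pow, ht, one_pow, TensorProduct.tmul_zero, smul_zero,
      add_zero]
  have hsq : Δ t ^ (2 * p) =
      (t ^ (2 * p)) ⊗ₜ[k] (1 : A) + (1 : A) ⊗ₜ[k] (t ^ (2 * p)) +
        (2 : k) • ((t ^ p) ⊗ₜ[k] (t ^ p)) := by
    rw [mul_comm 2 p, pow_mul, hp', add_sq, mul_assoc, two_smul]
    simp only [Algebra.TensorProduct.tmul_pow, Algebra.TensorProduct.tmul_mul_tmul, one_pow,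
      one_mul, mul_one, ← pow_mul]
    ring
  rw [map_sub, map_smul, map_pow, hsq, hΔ, smul_add, smul_smul, div_mul_cancel₀ a h2,
    smul_add, TensorProduct.sub_tmul, TensorProduct.tmul_sub, TensorProduct.tmul_smul,
    ← TensorProduct.smul_tmul']
  abel

/-- Let `k` be a field of characteristic `p > 2` and `a ∈ k`.  Let `A_{a,2}` be `k[T]/(T^{p²})`
with the bialgebra structure `Δₐ` in which `Δₐ(T̄) = T̄⊗1 + 1⊗T̄ + a • T̄^p ⊗ T̄^p`, and let
`A_{0,2}` be `k[T]/(T^{p²})` with the bialgebra structure `Δ₀` in which `T̄` is primitive; in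
both, the counit `ε` sends `T̄` to `0`.  Then `T̄ - (a/2)·T̄^{2p}` is primitive in `A_{a,2}`,
and the `k`-algebra endomorphism `φ` of `k[T]/(T^{p²})` with `φ(T̄) = T̄ - (a/2)·T̄^{2p}` is a
bialgebra isomorphism from `A_{0,2}` to `A_{a,2}`.  (`N` is the truncation order `p²`.) -/
theorem stmt_16 (k : Type*) [Field k] (p : ℕ) (hp : p.Prime) (hchar : CharP k p)
    (hp2 : 2 < p) (a : k) (N : ℕ) (hN : N = p ^ 2)
    (Δa Δ0 : TruncPoly k N →ₐ[k] TruncPoly k N ⊗[k] TruncPoly k N)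
    (ε : TruncPoly k N →ₐ[k] k)
    (hbia : IsBialgebraStructure k (TruncPoly k N) Δa ε)
    (hbi0 : IsBialgebraStructure k (TruncPoly k N) Δ0 ε)
    (hεT : ε (truncT k N) = 0)
    (hΔaT : Δa (truncT k N) =
      truncT k N ⊗ₜ[k] (1 : TruncPoly k N) + (1 : TruncPoly k N) ⊗ₜ[k] truncT k N +
        a • ((truncT k N ^ p) ⊗ₜ[k] (truncT k N ^ p)))
    (hΔ0T : Δ0 (truncT k N) =
      truncT k N ⊗ₜ[k] (1 : TruncPoly k N) + (1 : TruncPoly k N) ⊗ₜ[k] truncT k N)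
    (φ : TruncPoly k N →ₐ[k] TruncPoly k N)
    (hφT : φ (truncT k N) = truncT k N - (a / 2) • truncT k N ^ (2 * p)) :
    (Δa (truncT k N - (a / 2) • truncT k N ^ (2 * p)) =
      (truncT k N - (a / 2) • truncT k N ^ (2 * p)) ⊗ₜ[k] (1 : TruncPoly k N) +
        (1 : TruncPoly k N) ⊗ₜ[k] (truncT k N - (a / 2) • truncT k N ^ (2 * p))) ∧
    Function.Bijective φ ∧
    (∀ x, Δa (φ x) = (Algebra.TensorProduct.map φ φ) (Δ0 x)) ∧
    (∀ x, ε (φ x) = ε x) := by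
  have h2 : (2 : k) ≠ 0 := Ring.two_ne_zero (by rw [ringChar.eq k p]; omega)
  have : Fact p.Prime := ⟨hp⟩
  have : ExpChar k p := ExpChar.prime hp
  have : Nontrivial (TruncPoly k N) := ε.toRingHom.domain_nontrivial
  have : ExpChar (TruncPoly k N) p := expChar_of_injective_algebraMap
    (FaithfulSMul.algebraMap_injective k (TruncPoly k N)) p
  have ht : (truncT k N ^ p) ^ p = 0 := by
    rw [← pow_mul, ← sq, ← hN, truncT_pow_self]
  have hprim : Δa (truncT k N - (a / 2) • truncT k N ^ (2 * p)) =
      (truncT k N - (a / 2) • truncT k N ^ (2 * p)) ⊗ₜ[k] (1 : TruncPoly k N) +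
        (1 : TruncPoly k N) ⊗ₜ[k] (truncT k N - (a / 2) • truncT k N ^ (2 * p)) :=
    comul_sub_half_smul_pow p h2 a Δa _ ht hΔaT
  refine ⟨hprim, ?_, fun x ↦ ?_, fun x ↦ ?_⟩
  · apply TruncPoly.bijective_of_apply_eq φ
      (y := truncT k N + (a / 2) • truncT k N ^ (2 * p))
    have hφp : φ (truncT k N) ^ (2 * p) = truncT k N ^ (2 * p) := by
      rw [hφT, mul_comm 2 p, pow_mul, sub_pow_expChar, smul_pow, pow_mul, ← pow_mul _ 2 p,
        mul_comm 2 p, pow_mul, ht, zero_pow two_ne_zero, smul_zero, sub_zero, ← pow_mul]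
    rw [map_add, map_smul, map_pow, hφp, hφT, sub_add_cancel]
  · have h : Δa.comp φ = (Algebra.TensorProduct.map φ φ).comp Δ0 := by
      apply TruncPoly.algHom_ext
      simp only [AlgHom.comp_apply, hφT, hprim, hΔ0T, map_add, Algebra.TensorProduct.map_tmul,
        map_one]
    exact DFunLike.congr_fun h x
  · have h : ε.comp φ = ε := by
      apply TruncPoly.algHom_ext
      rw [AlgHom.comp_apply, hφT, map_sub, map_smul, map_pow, hεT,
        zero_pow (mul_ne_zero two_ne_zero hp.ne_zero), smul_zero, sub_zero]
    exact DFunLike.congr_fun h x
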